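/- Fix a real number α with 0 < α ≤ 1/2. There exists N such that for every odd integer n ≥ N, the unique tree T* on n vertices maximizing Ψ(T,α) = αλ₁(T) + (1-α)λ₂(T) over all trees T on n vertices is T* ≅ DC((n-3)/2, (n-3)/2, 3). -/

import Mathlib

open scoped Classical

/-- Adjacency matrix of a simple graph on `Fin n`, over `ℝ`. -/
noncomputable def adjMat {n : ℕ} (G : SimpleGraph (Fin n)) : Matrix (Fin n) (Fin n) ℝ :=
  fun i j => if G.Adj i j then 1 else 0

/-- The eigenvalues (roots of the characteristic polynomial, with multiplicity)
of the adjacency matrix, sorted in nondecreasing order. -/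
noncomputable def eigList {n : ℕ} (G : SimpleGraph (Fin n)) : List ℝ :=
  (Matrix.charpoly (adjMat G)).roots.sort (· ≤ ·)

/-- `lam k G` is the `k`-th largest adjacency eigenvalue of `G` (so `lam 1` is `λ₁`). -/
noncomputable def lam {n : ℕ} (k : ℕ) (G : SimpleGraph (Fin n)) : ℝ :=
  (eigList G).getD (n - k) 0

/-- The double comet `DC(k1, k2, l)`: a path on `l` vertices (the vertices `0, …, l-1`),
with `k1` pendant leaves attached to the terminal vertex `0` and `k2` pendant leaves
attached to the terminal vertex `l - 1`. -/
def doubleComet (k1 k2 l : ℕ) : SimpleGraph (Fin (k1 + k2 + l)) :=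
  SimpleGraph.fromRel (fun i j =>
    ((i : ℕ) + 1 = (j : ℕ) ∧ (j : ℕ) < l) ∨
    (l ≤ (i : ℕ) ∧ (i : ℕ) < l + k1 ∧ (j : ℕ) = 0) ∨
    (l + k1 ≤ (i : ℕ) ∧ (j : ℕ) = l - 1))

/-- Degree of a vertex. -/
noncomputable def deg {n : ℕ} (G : SimpleGraph (Fin n)) (u : Fin n) : ℕ :=
  (Finset.univ.filter (fun w => G.Adj u w)).card

lemma adjMat_isHermitian {n : ℕ} (G : SimpleGraph (Fin n)) : (adjMat G).IsHermitian := by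
  ext i j
  simp [adjMat, Matrix.conjTranspose_apply, G.adj_comm]

lemma adjMat_symm {n : ℕ} (G : SimpleGraph (Fin n)) (i j : Fin n) :
    adjMat G i j = adjMat G j i := by
  simp [adjMat, G.adj_comm]

lemma eigList_eq {n : ℕ} (G : SimpleGraph (Fin n)) :
    eigList G = (List.ofFn (adjMat_isHermitian G).eigenvalues₀).reverse := by
  unfold eigList
  have hs := (adjMat_isHermitian G).eigenvalues₀_antitone.sortedGE_ofFn
  have h1 : (adjMat G).charpoly.roots =
      (((List.ofFn (adjMat_isHermitian G).eigenvalues₀).reverse : List ℝ) : Multiset ℝ) := by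
    rw [(adjMat_isHermitian G).roots_charpoly_eq_eigenvalues₀, Fin.univ_val_map]
    simp only [Multiset.coe_reverse]
    rfl
  rw [h1, Multiset.coe_sort]
  apply List.mergeSort_of_pairwise
  have := hs.reverse.pairwise
  simpa using this

lemma lam_eq {n : ℕ} (G : SimpleGraph (Fin n)) (k : ℕ) (hk : 1 ≤ k) (hkn : k ≤ n) :
    lam k G = (adjMat_isHermitian G).eigenvalues₀ ⟨k - 1, by simp; omega⟩ := by
  unfold lam
  rw [eigList_eq, List.getD_eq_getElem _ _ (by simp; omega), List.getElem_reverse,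
    List.getElem_ofFn]
  congr 1
  ext
  simp
  omega

lemma lam_antitone {n : ℕ} (G : SimpleGraph (Fin n)) (hn : 2 ≤ n) : lam 2 G ≤ lam 1 G := by
  rw [lam_eq G 1 le_rfl (by omega), lam_eq G 2 (by omega) hn]
  apply (adjMat_isHermitian G).eigenvalues₀_antitone
  simp

/-- lower bounds -/
lemma lam_ge {n : ℕ} (G : SimpleGraph (Fin n)) (hn : 2 ≤ n) (a b : ℝ) (hab : b < a)
    (f g : Fin n → ℝ) (hf : f ≠ 0) (hg : g ≠ 0)
    (hfe : ∀ i, ∑ j, adjMat G i j * f j = a * f i)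
    (hge : ∀ i, ∑ j, adjMat G i j * g j = b * g i) : a ≤ lam 1 G ∧ b ≤ lam 2 G := by
  have key : ∀ (c : ℝ) (h : Fin n → ℝ), h ≠ 0 → (∀ i, ∑ j, adjMat G i j * h j = c * h i) →
      ∃ i, (adjMat_isHermitian G).eigenvalues₀ i = c := by
    intro c h hh he
    have hr : c ∈ (adjMat G).charpoly.roots := by
      rw [Polynomial.mem_roots (Matrix.charpoly_monic _).ne_zero, 
        ← Matrix.charpoly_toLin', ← Module.End.hasEigenvalue_iff_isRoot_charpoly]
      apply Module.End.hasEigenvalue_of_hasEigenvector (x := h)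
      rw [Module.End.hasEigenvector_iff, Module.End.mem_eigenspace_iff]
      refine ⟨?_, hh⟩
      ext i
      simpa [Matrix.mulVec, dotProduct] using he i
    rw [(adjMat_isHermitian G).roots_charpoly_eq_eigenvalues₀] at hr
    obtain ⟨i, -, hi⟩ := Multiset.mem_map.mp hr
    exact ⟨i, hi⟩
  obtain ⟨i, hi⟩ := key a f hf hfe
  obtain ⟨j, hj⟩ := key b g hg hge
  have anti := (adjMat_isHermitian G).eigenvalues₀_antitone
  have hij : i < j := by
    by_contra h
    have := anti (not_lt.mp h)
    linarith
  rw [lam_eq G 1 le_rfl (by omega), lam_eq G 2 (by omega) hn, ← hi, ← hj]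
  constructor
  · apply anti
    simp [Fin.le_def]
  · apply anti
    rw [Fin.lt_def] at hij
    simp [Fin.le_def]
    omega

lemma exists_eigvecs {n : ℕ} (G : SimpleGraph (Fin n)) (hn : 2 ≤ n) :
    ∃ u w : Fin n → ℝ, ∑ i, u i * u i = 1 ∧ ∑ i, w i * w i = 1 ∧ ∑ i, u i * w i = 0 ∧
      (∀ i, ∑ j, adjMat G i j * u j = lam 1 G * u i) ∧
      (∀ i, ∑ j, adjMat G i j * w j = lam 2 G * w i) := by
  set hA := adjMat_isHermitian G
  set e : Fin (Fintype.card (Fin n)) ≃ Fin n := Fintype.equivOfCardEq (Fintype.card_fin _) with he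
  have h0 : 1 - 1 < Fintype.card (Fin n) := by simp; omega
  have h1 : 2 - 1 < Fintype.card (Fin n) := by simp; omega
  set a := e ⟨1 - 1, h0⟩ with ha
  set b := e ⟨2 - 1, h1⟩ with hb
  have hab : a ≠ b := by
    rw [ha, hb]; intro h
    have := e.injective h
    simp at this
  have hon := hA.eigenvectorBasis.orthonormal
  rw [orthonormal_iff_ite] at hon
  have ea : hA.eigenvalues a = lam 1 G := by
    rw [lam_eq G 1 le_rfl (by omega)]
    unfold Matrix.IsHermitian.eigenvalues
    rw [ha, he, Equiv.symm_apply_apply]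
  have eb : hA.eigenvalues b = lam 2 G := by
    rw [lam_eq G 2 (by omega) (by omega)]
    unfold Matrix.IsHermitian.eigenvalues
    rw [hb, he, Equiv.symm_apply_apply]
  refine ⟨fun i => hA.eigenvectorBasis a i, fun i => hA.eigenvectorBasis b i, ?_, ?_, ?_, ?_, ?_⟩
  · have := hon a a
    rw [PiLp.inner_apply, if_pos rfl] at this
    exact this
  · have := hon b b
    rw [PiLp.inner_apply, if_pos rfl] at this
    exact this
  · have := hon b a
    rw [PiLp.inner_apply, if_neg hab.symm] at this
    exact this
  · intro i
    have := congrFun (hA.mulVec_eigenvectorBasis a) i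
    rw [ea] at this
    simpa [Matrix.mulVec, dotProduct] using this
  · intro i
    have := congrFun (hA.mulVec_eigenvectorBasis b) i
    rw [eb] at this
    simpa [Matrix.mulVec, dotProduct] using this

lemma bessel {n : ℕ} {ι : Type} [Fintype ι] [DecidableEq ι] (w : ι → Fin n → ℝ)
    (hw : ∀ a b, ∑ i, w a i * w b i = if a = b then 1 else 0) (r : Fin n → ℝ) :
    ∑ a, (∑ i, r i * w a i) ^ 2 ≤ ∑ i, r i ^ 2 := by
  have hon : Orthonormal ℝ (fun a => (WithLp.toLp 2 (w a) : EuclideanSpace ℝ (Fin n))) := by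
    rw [orthonormal_iff_ite]
    intro a b
    rw [← hw a b]
    simp [PiLp.inner_apply, mul_comm]
  have := hon.sum_inner_products_le (x := (WithLp.toLp 2 r : EuclideanSpace ℝ (Fin n)))
    (s := Finset.univ)
  simpa [PiLp.inner_apply, EuclideanSpace.norm_sq_eq] using this

lemma hs_bound {n : ℕ} {ι : Type} [Fintype ι] [DecidableEq ι] (A : Matrix (Fin n) (Fin n) ℝ)
    (w : ι → Fin n → ℝ) (μ : ι → ℝ)
    (hw : ∀ a b, ∑ i, w a i * w b i = if a = b then 1 else 0)
    (he : ∀ a i, ∑ j, A i j * w a j = μ a * w a i) :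
    ∑ a, μ a ^ 2 ≤ ∑ i, ∑ j, A i j ^ 2 := by
  have h : ∀ i, ∑ a, (μ a * w a i) ^ 2 ≤ ∑ j, A i j ^ 2 := by
    intro i
    have := bessel w hw (fun j => A i j)
    simpa [he] using this
  calc ∑ a, μ a ^ 2 = ∑ a, μ a ^ 2 * ∑ i, w a i * w a i := by simp [hw]
    _ = ∑ i, ∑ a, (μ a * w a i) ^ 2 := by
      rw [Finset.sum_comm]
      refine Finset.sum_congr rfl fun a _ => ?_
      rw [Finset.mul_sum]
      refine Finset.sum_congr rfl fun i _ => ?_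
      ring
    _ ≤ _ := Finset.sum_le_sum fun i _ => h i

lemma sum_adj_sq {n : ℕ} (G : SimpleGraph (Fin n)) (hT : G.IsTree) :
    ∑ i, ∑ j, adjMat G i j ^ 2 = 2 * ((n : ℝ) - 1) := by
  have h1 := G.sum_degrees_eq_twice_card_edges
  have h2 := hT.card_edgeFinset
  have h3 : ∀ i, ∑ j, adjMat G i j ^ 2 = (G.degree i : ℝ) := by
    intro i
    rw [← SimpleGraph.card_neighborFinset_eq_degree, SimpleGraph.neighborFinset_eq_filter]
    simp [adjMat]
  simp only [h3]
  rw [← Nat.cast_sum, h1]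
  simp at h2
  have h4 : (G.edgeFinset.card : ℝ) + 1 = n := by exact_mod_cast h2
  push_cast
  linarith

/-- Trace bounds for bipartite graphs. `ε` is the sign vector. -/
lemma trace_bound {n : ℕ} (G : SimpleGraph (Fin n)) (hT : G.IsTree) (ε : Fin n → ℝ)
    (hε : ∀ i, ε i * ε i = 1) (hadj : ∀ i j, G.Adj i j → ε i = - ε j)
    (u w : Fin n → ℝ) (s t : ℝ) (huu : ∑ i, u i * u i = 1) (hww : ∑ i, w i * w i = 1)
    (huw : ∑ i, u i * w i = 0) (hs : 0 < s)
    (hu : ∀ i, ∑ j, adjMat G i j * u j = s * u i)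
    (hw : ∀ i, ∑ j, adjMat G i j * w j = t * w i) :
    s ^ 2 ≤ n - 1 ∧ (0 < t → s ^ 2 + t ^ 2 ≤ n - 1) := by
  have hA : ∀ i j, adjMat G i j * ε j = - (ε i * adjMat G i j) := by
    intro i j
    unfold adjMat
    split_ifs with h
    · rw [hadj i j h]; ring
    · simp
  have flip : ∀ (f : Fin n → ℝ) (c : ℝ), (∀ i, ∑ j, adjMat G i j * f j = c * f i) →
      ∀ i, ∑ j, adjMat G i j * (ε j * f j) = (-c) * (ε i * f i) := by
    intro f c hf i
    have : ∀ j, adjMat G i j * (ε j * f j) = - ε i * (adjMat G i j * f j) := by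
      intro j
      rw [← mul_assoc, hA]; ring
    simp only [this]
    rw [← Finset.mul_sum, hf]; ring
  have orth : ∀ (f g : Fin n → ℝ) (c d : ℝ), (∀ i, ∑ j, adjMat G i j * f j = c * f i) →
      (∀ i, ∑ j, adjMat G i j * g j = d * g i) → c ≠ d → ∑ i, f i * g i = 0 := by
    intro f g c d hf hg hcd
    have e1 : ∑ i, (∑ j, adjMat G i j * f j) * g i = ∑ j, f j * ∑ i, adjMat G j i * g i := by
      simp only [Finset.sum_mul, Finset.mul_sum]
      rw [Finset.sum_comm]
      refine Finset.sum_congr rfl fun j _ => Finset.sum_congr rfl fun i _ => ?_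
      rw [adjMat_symm G i j]; ring
    simp only [hf, hg] at e1
    have e2 : c * ∑ i, f i * g i = d * ∑ i, f i * g i := by
      simp only [Finset.mul_sum]
      convert e1 using 2
      · ring
      · ring
    by_contra h
    exact hcd (mul_right_cancel₀ h e2)
  have norm : ∀ f g : Fin n → ℝ, ∑ i, (ε i * f i) * (ε i * g i) = ∑ i, f i * g i := by
    intro f g
    refine Finset.sum_congr rfl fun i _ => ?_
    linear_combination (f i * g i) * hε i
  have hu' := flip u s hu
  have hw' := flip w t hw
  have sw : ∀ f g : Fin n → ℝ, ∑ i, f i * g i = ∑ i, g i * f i := fun f g =>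
    Finset.sum_congr rfl fun i _ => mul_comm _ _
  have h1 := orth u _ s _ hu hu' (by linarith)
  have tot := sum_adj_sq G hT
  constructor
  · have := hs_bound (adjMat G) (ι := Fin 2) ![u, fun i => ε i * u i] ![s, -s] (by
      intro a b
      fin_cases a <;> fin_cases b
      · simpa using huu
      · simpa using h1
      · simpa [mul_comm, mul_assoc] using h1
      · simpa using (norm u u).trans huu) (by
      intro a i
      fin_cases a
      · simpa using hu i
      · simpa using hu' i)
    simp [Fin.sum_univ_two] at this
    linarith
  · intro ht
    have h2 := orth w _ t _ hw hw' (by linarith)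
    have h3 := orth u _ s _ hu hw' (by linarith)
    have h4 := orth w _ t _ hw hu' (by linarith)
    have h5 := norm u u
    have h6 := norm w w
    have h7 := norm u w
    have h8 := norm w u
    rw [huu] at h5
    rw [hww] at h6
    rw [huw] at h7
    rw [sw w u, huw] at h8
    have h1' := h1
    rw [sw] at h1'
    have h2' := h2
    rw [sw] at h2'
    have h3' := h3
    rw [sw] at h3'
    have h4' := h4
    rw [sw] at h4'
    have huw' := huw
    rw [sw] at huw'
    have := hs_bound (adjMat G) (ι := Fin 4) ![u, fun i => ε i * u i, w, fun i => ε i * w i]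
      ![s, -s, t, -t] (by
      intro a b
      fin_cases a <;> fin_cases b <;> simp <;> assumption) (by
      intro a i
      fin_cases a
      · simpa using hu i
      · simpa using hu' i
      · simpa using hw i
      · simpa using hw' i)
    simp [Fin.sum_univ_four] at this
    linarith

section graphpart

variable {n : ℕ} {T : SimpleGraph (Fin n)}

lemma tree_step (hT : T.IsTree) (z u : Fin n) (h : u ≠ z) :
    ∃ v, T.Adj u v ∧ T.dist z u = T.dist z v + 1 := by
  obtain ⟨p, hp⟩ := hT.connected.exists_walk_length_eq_dist u z
  cases p with
  | nil => exact absurd rfl h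
  | @cons _ v _ hadj q =>
    refine ⟨v, hadj, ?_⟩
    have h1 := SimpleGraph.dist_le q
    have h2 := hT.dist_eq_dist_add_one_of_adj z hadj
    rw [SimpleGraph.Walk.length_cons] at hp
    rw [T.dist_comm] at h1 hp
    omega

lemma tree_unique (hT : T.IsTree) (z u v w : Fin n) (h1 : T.Adj u v) (h2 : T.Adj u w)
    (hv : T.dist z u = T.dist z v + 1) (hw : T.dist z u = T.dist z w + 1) : v = w := by
  obtain ⟨p, hp⟩ := hT.connected.exists_walk_length_eq_dist v z
  obtain ⟨q, hq⟩ := hT.connected.exists_walk_length_eq_dist w z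
  have e1 : (SimpleGraph.Walk.cons h1 p).IsPath := by
    apply SimpleGraph.Walk.isPath_of_length_eq_dist
    rw [SimpleGraph.Walk.length_cons, hp, T.dist_comm, ← hv, T.dist_comm]
  have e2 : (SimpleGraph.Walk.cons h2 q).IsPath := by
    apply SimpleGraph.Walk.isPath_of_length_eq_dist
    rw [SimpleGraph.Walk.length_cons, hq, T.dist_comm, ← hw, T.dist_comm]
  have := (hT.isAcyclic.subsingleton_path u z).elim ⟨_, e1⟩ ⟨_, e2⟩
  have := congrArg (fun r : T.Path u z => r.1.snd) this
  simpa using this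

lemma centroid (hT : T.IsTree) (k : ℕ) (hn : n ≤ 2 * k + 3) :
    ∃ v, ∀ u, T.Adj v u →
      (Finset.univ.filter fun z => T.dist z v = T.dist z u + 1).card ≤ k + 1 := by
  by_contra hcon
  push Not at hcon
  set f : Fin n × Fin n → ℕ := fun q =>
    (Finset.univ.filter fun z => T.dist z q.1 = T.dist z q.2 + 1).card with hf
  set S : Finset (Fin n × Fin n) := Finset.univ.filter fun q => T.Adj q.1 q.2 ∧ k + 1 < f q with hS
  have hne : S.Nonempty := by
    have : Nonempty (Fin n) := hT.connected.nonempty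
    obtain ⟨v⟩ := this
    obtain ⟨u, h1, h2⟩ := hcon v
    exact ⟨(v, u), by simp only [hS, Finset.mem_filter, Finset.mem_univ, true_and]; exact ⟨h1, h2⟩⟩
  obtain ⟨⟨v, u⟩, hm, hmin⟩ := Finset.exists_min_image S f hne
  simp only [hS, Finset.mem_filter, Finset.mem_univ, true_and] at hm
  obtain ⟨hvu, hbig⟩ := hm
  obtain ⟨w, huw, hw⟩ := hcon u
  by_cases hwv : w = v
  · subst hwv
    have hd : Disjoint (Finset.univ.filter fun z => T.dist z u = T.dist z w + 1)
        (Finset.univ.filter fun z => T.dist z w = T.dist z u + 1) := by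
      rw [Finset.disjoint_filter]
      intro z _ h1 h2
      omega
    have := Finset.card_union_of_disjoint hd
    have h3 := Finset.card_le_univ ((Finset.univ.filter fun z => T.dist z u = T.dist z w + 1) ∪
        (Finset.univ.filter fun z => T.dist z w = T.dist z u + 1))
    simp only [Fintype.card_fin] at h3
    simp only [hf] at hbig
    omega
  · have h1 := hmin (u, w) (by
      simp only [hS, Finset.mem_filter, Finset.mem_univ, true_and]; exact ⟨huw, hw⟩)
    have h2 : f (u, w) < f (v, u) := by
      apply Finset.card_lt_card
      rw [Finset.ssubset_iff_of_subset]
      · refine ⟨u, ?_, ?_⟩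
        · simp [SimpleGraph.dist_eq_one_iff_adj, hvu.symm]
        · simp
      · intro z
        simp only [Finset.mem_filter, Finset.mem_univ, true_and]
        intro hz
        rcases hT.dist_eq_dist_add_one_of_adj z hvu with h | h
        · exact h
        · exact absurd (tree_unique hT z u w v huw hvu.symm hz h) hwv
    omega

/-- Branch data of a tree at a centroid. -/
lemma branches (hT : T.IsTree) (k : ℕ) (hn : n ≤ 2 * k + 3) :
    ∃ (v : Fin n) (b : Fin n → Fin n) (c : Fin n → Prop),
      (∀ z, z ≠ v → T.Adj v (b z)) ∧ b v = v ∧ (∀ w, T.Adj v w → b w = w) ∧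
      (∀ i j, T.Adj i j → i ≠ v → j ≠ v → b i = b j) ∧
      (∀ u, u ≠ v → (Finset.univ.filter fun z => b z = u).card ≤ k + 1) ∧
      (∀ i j, T.Adj i j → (c i ↔ ¬ c j)) ∧
      (∀ u, T.Adj v u → ((Finset.univ.filter fun q : Fin n × Fin n =>
        (b q.1 = u ∧ c q.1) ∧ (b q.2 = u ∧ ¬ c q.2) ∧ T.Adj q.1 q.2).card + 1 ≤
          (Finset.univ.filter fun z => b z = u).card)) ∧
      (∀ u, T.Adj v u → 2 ≤ (Finset.univ.filter fun z => b z = u).card → 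
        ∀ z, b z = u → ∃ w, b w = u ∧ T.Adj z w) := by
  obtain ⟨v, hv⟩ := centroid hT k hn
  have hb : ∀ z, ∃ u, (z = v → u = v) ∧ (z ≠ v → T.Adj v u ∧ T.dist z v = T.dist z u + 1) := by
    intro z
    by_cases h : z = v
    · exact ⟨v, fun _ => rfl, fun h' => absurd h h'⟩
    · obtain ⟨u, h1, h2⟩ := tree_step hT z v (Ne.symm h)
      exact ⟨u, fun h' => absurd h' h, fun _ => ⟨h1, h2⟩⟩
  choose b hbv hb using hb
  have hbiff : ∀ u, T.Adj v u → ∀ z, b z = u ↔ T.dist z v = T.dist z u + 1 := by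
    intro u hu z
    constructor
    · intro h
      have hz : z ≠ v := by
        intro hz
        rw [hbv z hz] at h
        exact hu.ne h
      rw [← h]
      exact (hb z hz).2
    · intro h
      have hz : z ≠ v := by
        intro hz
        subst hz
        simp at h
      exact tree_unique hT z v _ _ (hb z hz).1 hu (hb z hz).2 h
  have hbw : ∀ w, T.Adj v w → b w = w := by
    intro w hw
    rw [hbiff w hw]
    simp [SimpleGraph.dist_eq_one_iff_adj, hw.symm]
  -- children lie in the same branch
  have hsame0 : ∀ i j, T.Adj i j → i ≠ v → j ≠ v → T.dist v j = T.dist v i + 1 → b i = b j := by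
    intro i j hij hi hj h
    symm
    rw [hbiff _ (hb i hi).1]
    have h2 := (hb i hi).2
    have h3 := hT.dist_eq_dist_add_one_of_adj (b i) hij
    have h4 := hT.dist_eq_dist_add_one_of_adj j (hb i hi).1
    rw [T.dist_comm (u := i)] at h2
    rw [T.dist_comm (u := i)] at h2
    rw [T.dist_comm (u := j), T.dist_comm (u := j)] at h4 ⊢
    omega
  have hsame : ∀ i j, T.Adj i j → i ≠ v → j ≠ v → b i = b j := by
    intro i j hij hi hj
    rcases hT.dist_eq_dist_add_one_of_adj v hij with h | h
    · exact (hsame0 j i hij.symm hj hi h).symm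
    · exact hsame0 i j hij hi hj h
  refine ⟨v, b, fun z => Even (T.dist v z), fun z hz => (hb z hz).1, hbv v rfl, hbw, hsame,
    ?_, ?_, ?_, ?_⟩
  · intro u huv
    by_cases hu : T.Adj v u
    · have := hv u hu
      simp only [← hbiff u hu] at this
      exact this
    · rw [Finset.card_eq_zero.mpr]
      · omega
      · rw [Finset.filter_eq_empty_iff]
        intro z _ hz
        by_cases h : z = v
        · rw [hbv z h] at hz
          exact huv hz.symm
        · exact hu (hz ▸ (hb z h).1)
  · intro i j hij
    have := hT.dist_eq_dist_add_one_of_adj v hij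
    grind
  · intro u hu
    have hneq : ∀ z, b z = u → z ≠ v := by
      intro z hz h
      rw [hbv z h] at hz
      exact hu.ne hz
    have hmem : u ∈ (Finset.univ.filter fun z => b z = u) := by simp [hbw u hu]
    rw [← Finset.card_erase_add_one hmem]
    apply Nat.add_le_add_right
    apply Finset.card_le_card_of_injOn
      (fun q : Fin n × Fin n => if T.dist v q.1 = T.dist v q.2 + 1 then q.1 else q.2)
    · intro q hq
      simp only [Finset.coe_filter, Set.mem_ofPred_eq, Finset.mem_univ, true_and] at hq
      obtain ⟨⟨h1, h2⟩, ⟨h3, h4⟩, h5⟩ := hq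
      have aux : ∀ i j, T.Adj i j → j ≠ v → T.dist v i = T.dist v j + 1 → i ≠ u := by
        intro i j hij hj hd hi
        subst hi
        rw [SimpleGraph.dist_eq_one_iff_adj.mpr hu] at hd
        have : T.dist v j = 0 := by omega
        rw [hT.connected.dist_eq_zero_iff] at this
        exact hj this.symm
      simp only [Finset.coe_erase, Finset.coe_filter, Finset.mem_univ, true_and]
      split_ifs with h
      · exact ⟨h1, aux _ _ h5 (hneq _ h3) h⟩
      · refine ⟨h3, aux _ _ h5.symm (hneq _ h1) ?_⟩
        rcases hT.dist_eq_dist_add_one_of_adj v h5 with h' | h'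
        · exact absurd h' h
        · exact h'
    · rintro ⟨i, j⟩ hq ⟨i', j'⟩ hq' he
      simp only [Finset.coe_filter, Set.mem_ofPred_eq, Finset.mem_univ, true_and] at hq hq' he
      obtain ⟨⟨h1, h2⟩, ⟨h3, h4⟩, h5⟩ := hq
      obtain ⟨⟨h1', h2'⟩, ⟨h3', h4'⟩, h5'⟩ := hq'
      have d1 := hT.dist_eq_dist_add_one_of_adj v h5
      have d2 := hT.dist_eq_dist_add_one_of_adj v h5'
      split_ifs at he with a a'
      · subst he
        rw [tree_unique hT v i j j' h5 h5' a a']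
      · exact absurd (he ▸ h2) h4'
      · exact absurd (he ▸ h2') h4
      · subst he
        rw [tree_unique hT v j i i' h5.symm h5'.symm (by omega) (by omega)]
  · intro u hu hcard z hz
    have hneq : ∀ z, b z = u → z ≠ v := by
      intro z hz h
      rw [hbv z h] at hz
      exact hu.ne hz
    by_cases hzu : z = u
    · subst hzu
      obtain ⟨y, hy, hyz⟩ := Finset.exists_mem_ne (lt_of_lt_of_le one_lt_two hcard) z
      simp only [Finset.mem_filter, Finset.mem_univ, true_and] at hy
      obtain ⟨w, hw1, hw2⟩ := tree_step hT y z hyz.symm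
      have hwv : w ≠ v := by
        rintro rfl
        have := (hbiff z hu y).mp hy
        omega
      exact ⟨w, by rw [← hsame z w hw1 hu.ne' hwv, hz], hw1⟩
    · obtain ⟨w, hw1, hw2⟩ := tree_step hT v z (hneq z hz)
      have hwv : w ≠ v := by
        rintro rfl
        exact hzu (by rw [← hbw z hw1.symm, hz])
      exact ⟨w, by rw [← hsame z w hw1 (hneq z hz) hwv, hz], hw1⟩

end graphpart

lemma branch_bound {n : ℕ} (G : SimpleGraph (Fin n)) (B : Finset (Fin n)) (c : Fin n → Prop)
    (hc : ∀ i j, G.Adj i j → (c i ↔ ¬ c j)) (K : ℝ) (hK : 0 < K)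
    (hm : (((B.filter c ×ˢ B.filter (fun z => ¬ c z)).filter
      fun q : Fin n × Fin n => G.Adj q.1 q.2).card : ℝ) ≤ K) (x : Fin n → ℝ) :
    (∑ i ∈ B, ∑ j ∈ B, adjMat G i j * (x i * x j) ≤ √K * ∑ i ∈ B, x i ^ 2) ∧
    (∑ i ∈ B, ∑ j ∈ B, adjMat G i j * (x i * x j) = √K * ∑ i ∈ B, x i ^ 2 →
      (∃ i ∈ B, x i ≠ 0) →
      (((B.filter c ×ˢ B.filter (fun z => ¬ c z)).filter
        fun q : Fin n × Fin n => G.Adj q.1 q.2).card : ℝ) = K ∧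
      (B.filter c).Nonempty ∧ (B.filter (fun z => ¬ c z)).Nonempty ∧
      ∀ i ∈ B, ∀ j ∈ B, c i → ¬ c j → (G.Adj i j ↔ x i ≠ 0 ∧ x j ≠ 0)) := by
  set B0 := B.filter c with hB0
  set B1 := B.filter (fun z => ¬ c z) with hB1
  set a := ∑ i ∈ B0, x i ^ 2 with ha
  set b := ∑ i ∈ B1, x i ^ 2 with hb
  have ha0 : 0 ≤ a := Finset.sum_nonneg fun i _ => sq_nonneg _
  have hb0 : 0 ≤ b := Finset.sum_nonneg fun i _ => sq_nonneg _
  have hsplit : ∀ f : Fin n → ℝ, ∑ i ∈ B, f i = ∑ i ∈ B0, f i + ∑ i ∈ B1, f i := fun f =>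
    (Finset.sum_filter_add_sum_filter_not B c f).symm
  have hab : ∑ i ∈ B, x i ^ 2 = a + b := hsplit _
  set Q := B0 ×ˢ B1 with hQ
  set m : ℝ := ((Q.filter fun q : Fin n × Fin n => G.Adj q.1 q.2).card : ℝ) with hmdef
  set P := ∑ q ∈ Q, adjMat G q.1 q.2 * (x q.1 * x q.2) with hP
  have hA2 : ∑ q ∈ Q, adjMat G q.1 q.2 ^ 2 = m := by
    simp [adjMat, hmdef]
  have hy2 : ∑ q ∈ Q, (x q.1 * x q.2) ^ 2 = a * b := by
    rw [hQ, Finset.sum_product, ha, hb, Finset.sum_mul_sum]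
    simp only [mul_pow]
  have z0 : ∑ i ∈ B0, ∑ j ∈ B0, adjMat G i j * (x i * x j) = 0 := by
    refine Finset.sum_eq_zero fun i hi => Finset.sum_eq_zero fun j hj => ?_
    simp only [hB0, Finset.mem_filter] at hi hj
    have : ¬ G.Adj i j := fun h => ((hc i j h).mp hi.2) hj.2
    simp [adjMat, this]
  have z1 : ∑ i ∈ B1, ∑ j ∈ B1, adjMat G i j * (x i * x j) = 0 := by
    refine Finset.sum_eq_zero fun i hi => Finset.sum_eq_zero fun j hj => ?_
    simp only [hB1, Finset.mem_filter] at hi hj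
    have : ¬ G.Adj i j := fun h => hi.2 ((hc i j h).mpr hj.2)
    simp [adjMat, this]
  have hS : ∑ i ∈ B, ∑ j ∈ B, adjMat G i j * (x i * x j) = 2 * P := by
    have e1 : ∑ i ∈ B0, ∑ j ∈ B1, adjMat G i j * (x i * x j) = P := by
      rw [hP, hQ, Finset.sum_product]
    have e2 : ∑ i ∈ B1, ∑ j ∈ B0, adjMat G i j * (x i * x j) = P := by
      rw [Finset.sum_comm, ← e1]
      refine Finset.sum_congr rfl fun i _ => Finset.sum_congr rfl fun j _ => ?_
      rw [adjMat_symm, mul_comm (x j)]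
    rw [hsplit]
    simp only [hsplit, Finset.sum_add_distrib]
    rw [z0, z1, e1, e2]
    ring
  have hCS : P ^ 2 ≤ m * (a * b) := by
    rw [← hA2, ← hy2]
    exact Finset.sum_mul_sq_le_sq_mul_sq _ _ _
  have hKs : √K ^ 2 = K := Real.sq_sqrt hK.le
  have hKp : 0 < √K := Real.sqrt_pos.mpr hK
  have hmab : m * (a * b) ≤ K * (a * b) := by
    apply mul_le_mul_of_nonneg_right hm (mul_nonneg ha0 hb0)
  rw [hS, hab]
  constructor
  · apply le_of_sq_le_sq _ (by positivity)
    have : (√K * (a + b)) ^ 2 = K * (a + b) ^ 2 := by rw [mul_pow, hKs]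
    rw [this]
    nlinarith [mul_nonneg hK.le (sq_nonneg (a - b))]
  · intro heq hne
    have hpos : 0 < a + b := by
      rw [← hab]
      obtain ⟨i, hi, hxi⟩ := hne
      exact Finset.sum_pos' (fun i _ => sq_nonneg _) ⟨i, hi, by positivity⟩
    have hsq : 4 * P ^ 2 = K * (a + b) ^ 2 := by
      have : (2 * P) ^ 2 = K * (a + b) ^ 2 := by rw [heq, mul_pow, hKs]
      linarith
    have hab' : a = b := by
      have : K * (a - b) ^ 2 ≤ 0 := by nlinarith
      have h2 : (a - b) ^ 2 ≤ 0 := by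
        by_contra h
        push Not at h
        have := mul_pos hK h
        linarith
      have h3 : (a - b) ^ 2 = 0 := le_antisymm h2 (sq_nonneg _)
      have := pow_eq_zero_iff (two_ne_zero) |>.mp h3
      linarith
    have hap : 0 < a := by linarith
    have hbp : 0 < b := by linarith
    have habp : 0 < a * b := mul_pos hap hbp
    have hPeq : P ^ 2 = K * (a * b) := by
      rw [← hab'] at hsq ⊢; linarith
    have hmK : m = K := by
      have : K * (a * b) ≤ m * (a * b) := by linarith
      exact le_antisymm hm (le_of_mul_le_mul_right this habp)
    have hPp : 0 < P := by
      have : 0 < √K * (a + b) := by positivity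
      linarith
    have hzero : ∑ q ∈ Q, (adjMat G q.1 q.2 * (a * b) - (x q.1 * x q.2) * P) ^ 2 = 0 := by
      have : ∀ q : Fin n × Fin n, (adjMat G q.1 q.2 * (a * b) - (x q.1 * x q.2) * P) ^ 2 =
          (a * b) ^ 2 * adjMat G q.1 q.2 ^ 2 - (2 * (a * b) * P) *
            (adjMat G q.1 q.2 * (x q.1 * x q.2)) + P ^ 2 * (x q.1 * x q.2) ^ 2 := by
        intro q; ring
      simp only [this]
      rw [Finset.sum_add_distrib, Finset.sum_sub_distrib, ← Finset.mul_sum, ← Finset.mul_sum,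
        ← Finset.mul_sum, hA2, hy2, ← hP, hmK]
      linear_combination (-(a * b)) * hPeq
    rw [Finset.sum_eq_zero_iff_of_nonneg (fun _ _ => sq_nonneg _)] at hzero
    refine ⟨hmK, ?_, ?_, ?_⟩
    · by_contra h
      rw [Finset.not_nonempty_iff_eq_empty] at h
      rw [ha, h] at hap
      simp at hap
    · by_contra h
      rw [Finset.not_nonempty_iff_eq_empty] at h
      rw [hb, h] at hbp
      simp at hbp
    · intro i hi j hj hci hcj
      have h1 := hzero (i, j) (by
        simp only [hQ, hB0, hB1, Finset.mem_product, Finset.mem_filter]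
        exact ⟨⟨hi, hci⟩, hj, hcj⟩)
      have h2 := pow_eq_zero_iff (two_ne_zero) |>.mp h1
      simp only [adjMat] at h2
      split_ifs at h2 with h
      · simp only [h, true_iff]
        constructor
        · intro h0; rw [h0] at h2; simp at h2; rcases h2 with h2 | h2 <;> linarith
        · intro h0; rw [h0] at h2; simp at h2; rcases h2 with h2 | h2 <;> linarith
      · simp only [h, false_iff]
        rintro ⟨h3, h4⟩
        have : x i * x j * P ≠ 0 := mul_ne_zero (mul_ne_zero h3 h4) hPp.ne'
        apply this
        linarith

lemma star_of_eq {n : ℕ} (G : SimpleGraph (Fin n)) (B : Finset (Fin n)) (c : Fin n → Prop)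
    (hc : ∀ i j, G.Adj i j → (c i ↔ ¬ c j)) (k : ℕ) (hk : 0 < k)
    (hBk : B.card ≤ k + 1)
    (hm : ((B.filter c ×ˢ B.filter (fun z => ¬ c z)).filter
      fun q : Fin n × Fin n => G.Adj q.1 q.2).card + 1 ≤ B.card)
    (hiso : 2 ≤ B.card → ∀ z ∈ B, ∃ w ∈ B, G.Adj z w)
    (x : Fin n → ℝ)
    (heq : ∑ i ∈ B, ∑ j ∈ B, adjMat G i j * (x i * x j) = √(k : ℝ) * ∑ i ∈ B, x i ^ 2)
    (hne : ∃ i ∈ B, x i ≠ 0) :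
    B.card = k + 1 ∧ (∀ i ∈ B, x i ≠ 0) ∧
    ∃ p ∈ B, ∀ z ∈ B, ∀ w ∈ B, G.Adj z w ↔ (z = p ∧ w ≠ p) ∨ (z ≠ p ∧ w = p) := by
  have hmk : ((B.filter c ×ˢ B.filter (fun z => ¬ c z)).filter
      fun q : Fin n × Fin n => G.Adj q.1 q.2).card ≤ k := by omega
  obtain ⟨h1, h2, h3, h4⟩ := (branch_bound G B c hc k (by exact_mod_cast hk)
    (by exact_mod_cast hmk) x).2 heq hne
  have h1' : ((B.filter c ×ˢ B.filter (fun z => ¬ c z)).filter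
      fun q : Fin n × Fin n => G.Adj q.1 q.2).card = k := by exact_mod_cast h1
  have hcard : B.card = k + 1 := by omega
  have hx : ∀ i ∈ B, x i ≠ 0 := by
    intro i hi
    obtain ⟨w, hw, hadj⟩ := hiso (by omega) i hi
    by_cases hci : c i
    · exact ((h4 i hi w hw hci ((hc i w hadj).mp hci)).mp hadj).1
    · have hcw : c w := by
        have := hc i w hadj
        tauto
      exact ((h4 w hw i hi hcw hci).mp hadj.symm).2
  have hadj : ∀ z ∈ B, ∀ w ∈ B, G.Adj z w ↔ (c z ↔ ¬ c w) := by
    intro z hz w hw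
    constructor
    · exact hc z w
    · intro h
      by_cases hcz : c z
      · exact (h4 z hz w hw hcz (h.mp hcz)).mpr ⟨hx z hz, hx w hw⟩
      · have hcw : c w := by tauto
        exact ((h4 w hw z hz hcw hcz).mpr ⟨hx w hw, hx z hz⟩).symm
  refine ⟨hcard, hx, ?_⟩
  have hfull : ((B.filter c ×ˢ B.filter (fun z => ¬ c z)).filter
      fun q : Fin n × Fin n => G.Adj q.1 q.2) = (B.filter c ×ˢ B.filter (fun z => ¬ c z)) := by
    apply Finset.filter_true_of_mem
    rintro ⟨i, j⟩ hq
    simp only [Finset.mem_product, Finset.mem_filter] at hq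
    exact (h4 i hq.1.1 j hq.2.1 hq.1.2 hq.2.2).mpr ⟨hx i hq.1.1, hx j hq.2.1⟩
  rw [hfull, Finset.card_product] at h1'
  have hsum := Finset.card_filter_add_card_filter_not (s := B) c
  rw [hcard] at hsum
  have hp0 := h2.card_pos
  have hp1 := h3.card_pos
  have hone : (B.filter c).card = 1 ∨ (B.filter (fun z => ¬ c z)).card = 1 := by
    by_contra h
    push Not at h
    obtain ⟨r, hr⟩ : ∃ r, (B.filter c).card = r + 2 := ⟨(B.filter c).card - 2, by omega⟩
    obtain ⟨s, hs⟩ : ∃ s, (B.filter (fun z => ¬ c z)).card = s + 2 :=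
      ⟨(B.filter (fun z => ¬ c z)).card - 2, by omega⟩
    rw [hr, hs] at h1' hsum
    nlinarith
  rcases hone with h | h
  · obtain ⟨p, hp⟩ := Finset.card_eq_one.mp h
    have hp' : ∀ z ∈ B, c z ↔ z = p := by
      intro z hz
      have : z ∈ B.filter c ↔ z = p := by rw [hp]; simp
      rw [Finset.mem_filter] at this
      tauto
    have hpB : p ∈ B := by
      have : p ∈ B.filter c := by rw [hp]; simp
      exact (Finset.mem_filter.mp this).1
    refine ⟨p, hpB, fun z hz w hw => ?_⟩
    rw [hadj z hz w hw, hp' z hz, hp' w hw]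
    tauto
  · obtain ⟨p, hp⟩ := Finset.card_eq_one.mp h
    have hp' : ∀ z ∈ B, ¬ c z ↔ z = p := by
      intro z hz
      have : z ∈ B.filter (fun z => ¬ c z) ↔ z = p := by rw [hp]; simp
      rw [Finset.mem_filter] at this
      tauto
    have hpB : p ∈ B := by
      have : p ∈ B.filter (fun z => ¬ c z) := by rw [hp]; simp
      exact (Finset.mem_filter.mp this).1
    refine ⟨p, hpB, fun z hz w hw => ?_⟩
    have a1 := hp' z hz
    have a2 := hp' w hw
    rw [hadj z hz w hw]
    tauto

/-- `T` consists of a vertex `v` joined to the vertices `r1`, `r2` of two stars with centres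
`p1`, `p2`, each having `k + 1` vertices. -/
structure TwoStars {n : ℕ} (T : SimpleGraph (Fin n)) (k : ℕ) (v r1 r2 p1 p2 : Fin n)
    (B1 B2 : Finset (Fin n)) : Prop where
  hr1 : r1 ∈ B1
  hr2 : r2 ∈ B2
  hp1 : p1 ∈ B1
  hp2 : p2 ∈ B2
  hv1 : v ∉ B1
  hv2 : v ∉ B2
  hd : Disjoint B1 B2
  hc1 : B1.card = k + 1
  hc2 : B2.card = k + 1
  hu : ∀ z, z = v ∨ z ∈ B1 ∨ z ∈ B2
  hs1 : ∀ z ∈ B1, ∀ w ∈ B1, T.Adj z w ↔ (z = p1 ∧ w ≠ p1) ∨ (z ≠ p1 ∧ w = p1)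
  hs2 : ∀ z ∈ B2, ∀ w ∈ B2, T.Adj z w ↔ (z = p2 ∧ w ≠ p2) ∨ (z ≠ p2 ∧ w = p2)
  ho1 : ∀ z ∈ B1, ∀ w, w ∉ B1 → (T.Adj z w ↔ z = r1 ∧ w = v)
  ho2 : ∀ z ∈ B2, ∀ w, w ∉ B2 → (T.Adj z w ↔ z = r2 ∧ w = v)

lemma second_bound {n k : ℕ} (hn : n = 2 * k + 3) (hk : 0 < k) (T : SimpleGraph (Fin n))
    (hT : T.IsTree) (u w : Fin n → ℝ) (s t : ℝ) (hst : t ≤ s)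
    (huu : ∑ i, u i * u i = 1) (hww : ∑ i, w i * w i = 1)
    (huw : ∑ i, u i * w i = 0)
    (hu : ∀ i, ∑ j, adjMat T i j * u j = s * u i)
    (hw : ∀ i, ∑ j, adjMat T i j * w j = t * w i) :
    t ≤ √(k : ℝ) ∧ (t = √(k : ℝ) → t < s →
      ∃ v r1 r2 p1 p2 B1 B2, TwoStars T k v r1 r2 p1 p2 B1 B2) := by
  obtain ⟨v, b, c, hb1, hbv, hb2, hsame, hcard, hc, hedge, hiso⟩ := branches hT k hn.le
  set F : Fin n → Finset (Fin n) := fun r => Finset.univ.filter fun z => b z = r with hF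
  have hmF : ∀ r z, z ∈ F r ↔ b z = r := by intro r z; simp [hF]
  have hKpos : (0 : ℝ) < k := by exact_mod_cast hk
  have hedge' : ∀ r, T.Adj v r → (((F r).filter c ×ˢ (F r).filter (fun z => ¬ c z)).filter
      fun q : Fin n × Fin n => T.Adj q.1 q.2).card + 1 ≤ (F r).card := by
    intro r hr
    have := hedge r hr
    convert this using 3
    ext q
    simp only [hF, Finset.mem_filter, Finset.mem_product, Finset.mem_univ, true_and]
    tauto
  have hvF : ∀ z, z ∈ F v → z = v := by
    intro z hz
    by_contra h
    have := hb1 z h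
    rw [(hmF v z).mp hz] at this
    exact this.ne rfl
  have hnF : ∀ r, r ≠ v → ¬ T.Adj v r → F r = ∅ := by
    intro r hrv hr
    rw [Finset.eq_empty_iff_forall_notMem]
    intro z hz
    rw [hmF] at hz
    by_cases h : z = v
    · rw [h, hbv] at hz; exact hrv hz.symm
    · exact hr (hz ▸ hb1 z h)
  have hterm : ∀ (x : Fin n → ℝ), x v = 0 → ∀ r,
      ∑ i ∈ F r, ∑ j ∈ F r, adjMat T i j * (x i * x j) ≤ √(k : ℝ) * ∑ i ∈ F r, x i ^ 2 := by
    intro x hx r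
    by_cases hr : T.Adj v r
    · refine (branch_bound T (F r) c hc k hKpos ?_ x).1
      have h1 := hedge' r hr
      have h2 := hcard r hr.ne'
      have h3 : (F r).card ≤ k + 1 := h2
      have : (((F r).filter c ×ˢ (F r).filter (fun z => ¬ c z)).filter
        fun q : Fin n × Fin n => T.Adj q.1 q.2).card ≤ k := by omega
      exact_mod_cast this
    · by_cases hrv : r = v
      · subst hrv
        rw [Finset.sum_eq_zero, Finset.sum_eq_zero]
        · simp
        · intro i hi; rw [hvF i hi, hx]; simp
        · intro i hi
          apply Finset.sum_eq_zero
          intro j hj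
          rw [hvF i hi, hx]; simp
      · rw [hnF r hrv hr]; simp
  have hdec1 : ∀ (x : Fin n → ℝ), x v = 0 → ∑ i, ∑ j, adjMat T i j * (x i * x j) =
      ∑ r, ∑ i ∈ F r, ∑ j ∈ F r, adjMat T i j * (x i * x j) := by
    intro x hx
    rw [← Finset.sum_fiberwise Finset.univ b]
    refine Finset.sum_congr rfl fun r _ => Finset.sum_congr rfl fun i hi => ?_
    symm
    apply Finset.sum_subset (Finset.subset_univ _)
    intro j _ hj
    have hi' : b i = r := (hmF r i).mp hi
    have hj' : b j ≠ r := by rwa [hmF] at hj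
    by_cases hiv : i = v
    · rw [hiv, hx]; simp
    by_cases hjv : j = v
    · rw [hjv, hx]; simp
    have : ¬ T.Adj i j := fun h => hj' ((hsame i j h hiv hjv) ▸ hi')
    simp [adjMat, this]
  have hdec2 : ∀ (x : Fin n → ℝ), √(k : ℝ) * ∑ i, x i ^ 2 =
      ∑ r, √(k : ℝ) * ∑ i ∈ F r, x i ^ 2 := by
    intro x
    rw [← Finset.mul_sum, ← Finset.sum_fiberwise Finset.univ b]
  have hbound : ∀ (x : Fin n → ℝ), x v = 0 → ∑ i, ∑ j, adjMat T i j * (x i * x j) ≤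
      √(k : ℝ) * ∑ i, x i ^ 2 := by
    intro x hx
    rw [hdec1 x hx, hdec2 x]
    exact Finset.sum_le_sum fun r _ => hterm x hx r
  -- interlacing
  have hray : ∀ p q : ℝ, p * u v + q * w v = 0 → p ^ 2 * s + q ^ 2 * t ≤ √(k : ℝ) * (p ^ 2 + q ^ 2) := by
    intro p q h0
    have h1 := hbound (fun i => p * u i + q * w i) h0
    have e1 : ∑ i, ∑ j, adjMat T i j * ((p * u i + q * w i) * (p * u j + q * w j)) =
        p ^ 2 * s + q ^ 2 * t := by
      have : ∀ i, ∑ j, adjMat T i j * ((p * u i + q * w i) * (p * u j + q * w j)) =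
          p ^ 2 * s * (u i * u i) + q ^ 2 * t * (w i * w i) + (p * q * (s + t)) * (u i * w i) := by
        intro i
        have : ∀ j, adjMat T i j * ((p * u i + q * w i) * (p * u j + q * w j)) =
          ((p * u i + q * w i) * p) * (adjMat T i j * u j) +
          ((p * u i + q * w i) * q) * (adjMat T i j * w j) := by intro j; ring
        simp only [this]
        rw [Finset.sum_add_distrib, ← Finset.mul_sum, ← Finset.mul_sum, hu, hw]
        ring
      simp only [this]
      rw [Finset.sum_add_distrib, Finset.sum_add_distrib, ← Finset.mul_sum, ← Finset.mul_sum,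
        ← Finset.mul_sum, huu, hww, huw]
      ring
    have e2 : ∑ i, (p * u i + q * w i) ^ 2 = p ^ 2 + q ^ 2 := by
      have : ∀ i, (p * u i + q * w i) ^ 2 = p ^ 2 * (u i * u i) + q ^ 2 * (w i * w i) +
          (2 * p * q) * (u i * w i) := by intro i; ring
      simp only [this]
      rw [Finset.sum_add_distrib, Finset.sum_add_distrib, ← Finset.mul_sum, ← Finset.mul_sum,
        ← Finset.mul_sum, huu, hww, huw]
      ring
    rw [e1, e2] at h1
    exact h1
  obtain ⟨p, q, hpq0, hpq⟩ : ∃ p q : ℝ, p * u v + q * w v = 0 ∧ 0 < p ^ 2 + q ^ 2 := by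
    by_cases h : w v = 0
    · exact ⟨0, 1, by simp [h], by norm_num⟩
    · exact ⟨w v, - u v, by ring, by positivity⟩
  have hr := hray p q hpq0
  have hp2 := mul_le_mul_of_nonneg_left hst (sq_nonneg p)
  constructor
  · have : t * (p ^ 2 + q ^ 2) ≤ √(k : ℝ) * (p ^ 2 + q ^ 2) := by linarith
    exact le_of_mul_le_mul_right this hpq
  intro ht hts
  have hp : p = 0 := by
    have : p ^ 2 * (s - t) ≤ 0 := by rw [← ht] at hr; linarith
    by_contra h
    have : 0 < p ^ 2 * (s - t) := mul_pos (by positivity) (by linarith)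
    linarith
  have hq : q ≠ 0 := by
    rintro rfl
    rw [hp] at hpq; simp at hpq
  have hwv : w v = 0 := by
    rw [hp] at hpq0
    simpa [hq] using hpq0
  have heqs : ∀ r, ∑ i ∈ F r, ∑ j ∈ F r, adjMat T i j * (w i * w j) =
      √(k : ℝ) * ∑ i ∈ F r, w i ^ 2 := by
    have e : ∑ r, ∑ i ∈ F r, ∑ j ∈ F r, adjMat T i j * (w i * w j) =
        ∑ r, √(k : ℝ) * ∑ i ∈ F r, w i ^ 2 := by
      rw [← hdec1 w hwv, ← hdec2 w, ← ht]
      rw [Finset.mul_sum]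
      refine Finset.sum_congr rfl fun i _ => ?_
      have : ∀ j, adjMat T i j * (w i * w j) = w i * (adjMat T i j * w j) := by intro j; ring
      simp only [this]
      rw [← Finset.mul_sum, hw]; ring
    rw [Finset.sum_eq_sum_iff_of_le (fun r _ => hterm w hwv r)] at e
    exact fun r => e r (Finset.mem_univ r)
  have hstar : ∀ r, T.Adj v r → (∃ i ∈ F r, w i ≠ 0) → (F r).card = k + 1 ∧
      (∀ i ∈ F r, w i ≠ 0) ∧ ∃ p ∈ F r, ∀ z ∈ F r, ∀ y ∈ F r,
        T.Adj z y ↔ (z = p ∧ y ≠ p) ∨ (z ≠ p ∧ y = p) := by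
    intro r hr hne
    refine star_of_eq T (F r) c hc k hk (hcard r hr.ne') (hedge' r hr) ?_ w (heqs r) hne
    intro h z hz
    obtain ⟨y, hy, hzy⟩ := hiso r hr h z ((hmF r z).mp hz)
    exact ⟨y, (hmF r y).mpr hy, hzy⟩
  obtain ⟨z, hz⟩ : ∃ z, w z ≠ 0 := by
    by_contra h
    push Not at h
    simp [h] at hww
  have hzv : z ≠ v := fun h => hz (h ▸ hwv)
  have hr1 := hb1 z hzv
  set r1 := b z with hr1def
  obtain ⟨hk1, hx1, p1, hp1, hs1⟩ := hstar r1 hr1 ⟨z, (hmF r1 z).mpr rfl, hz⟩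
  have hself : ∀ r, T.Adj v r → r ∈ F r := fun r hr => (hmF r r).mpr (hb2 r hr)
  obtain ⟨r2, hr2, hne, hw2⟩ : ∃ r2, T.Adj v r2 ∧ r2 ≠ r1 ∧ w r2 ≠ 0 := by
    by_contra hcon
    push Not at hcon
    have h1 := hw v
    rw [hwv, mul_zero, Finset.sum_eq_single r1] at h1
    · simp [adjMat, hr1] at h1
      exact hx1 r1 (hself r1 hr1) h1
    · intro j _ hj
      by_cases h : T.Adj v j
      · rw [hcon j h hj]; simp
      · simp [adjMat, h]
    · simp
  obtain ⟨hk2, hx2, p2, hp2, hs2⟩ := hstar r2 hr2 ⟨r2, hself r2 hr2, hw2⟩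
  have hvn : ∀ r, T.Adj v r → v ∉ F r := by
    intro r hr h
    rw [hmF, hbv] at h
    exact hr.ne h
  have hd : Disjoint (F r1) (F r2) := by
    rw [Finset.disjoint_left]
    intro y h1 h2
    rw [hmF] at h1 h2
    exact hne (h2.symm.trans h1)
  have hout : ∀ r, T.Adj v r → ∀ z ∈ F r, ∀ y, y ∉ F r → (T.Adj z y ↔ z = r ∧ y = v) := by
    intro r hr z hz y hy
    constructor
    · intro h
      have hzv : z ≠ v := fun h' => hvn r hr (h' ▸ hz)
      have hyv : y = v := by
        by_contra hyv
        apply hy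
        rw [hmF] at hz ⊢
        rw [← hsame z y h hzv hyv, hz]
      subst hyv
      refine ⟨?_, rfl⟩
      rw [← hb2 z h.symm]
      exact (hmF r z).mp hz
    · rintro ⟨rfl, rfl⟩
      exact hr.symm
  refine ⟨v, r1, r2, p1, p2, F r1, F r2, hself r1 hr1, hself r2 hr2, hp1, hp2, hvn r1 hr1,
    hvn r2 hr2, hd, hk1, hk2, ?_, hs1, hs2, hout r1 hr1, hout r2 hr2⟩
  have huniv : insert v (F r1 ∪ F r2) = Finset.univ := by
    apply Finset.eq_univ_of_card
    rw [Finset.card_insert_of_notMem, Finset.card_union_of_disjoint hd, hk1, hk2, Fintype.card_fin]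
    · omega
    · rw [Finset.mem_union]
      rintro (h | h)
      · exact hvn r1 hr1 h
      · exact hvn r2 hr2 h
  intro y
  have := Finset.mem_univ y
  rw [← huniv] at this
  simpa using this

lemma star_eig {n k : ℕ} (T : SimpleGraph (Fin n)) (v r p : Fin n) (B : Finset (Fin n))
    (hr : r ∈ B) (hp : p ∈ B) (hv : v ∉ B) (hc : B.card = k + 1)
    (hs : ∀ z ∈ B, ∀ w ∈ B, T.Adj z w ↔ (z = p ∧ w ≠ p) ∨ (z ≠ p ∧ w = p))
    (ho : ∀ z ∈ B, ∀ w, w ∉ B → (T.Adj z w ↔ z = r ∧ w = v))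
    (y : Fin n → ℝ) (μ : ℝ) (hμ0 : 0 < μ) (hμ : μ ^ 2 = k + 2)
    (hy : ∀ i, ∑ j, adjMat T i j * y j = μ * y i) :
    (r = p → 2 * y r = μ * y v) ∧ (r ≠ p → 2 * μ * y r = 3 * y v) ∧
      (y v = 0 → ∀ z ∈ B, y z = 0) := by
  have hsum : ∀ z ∈ B, ∑ j, adjMat T z j * y j =
      ∑ j ∈ B, adjMat T z j * y j + (if z = r then y v else 0) := by
    intro z hz
    rw [← Finset.sum_add_sum_compl B]
    congr 1
    rw [Finset.sum_eq_single v]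
    · have := ho z hz v hv
      simp [adjMat, this]
    · intro j hj hjv
      rw [Finset.mem_compl] at hj
      have := ho z hz j hj
      simp [adjMat, this, hjv]
    · intro h
      exact absurd (Finset.mem_compl.mpr hv) h
  have hleaf : ∀ z ∈ B, z ≠ p → y p + (if z = r then y v else 0) = μ * y z := by
    intro z hz hzp
    rw [← hy z, hsum z hz]
    congr 1
    rw [Finset.sum_eq_single p]
    · have := hs z hz p hp
      simp [adjMat, this, hzp]
    · intro j hj hjp
      have := hs z hz j hj
      simp [adjMat, this, hjp, hzp]
    · intro h; exact absurd hp h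
  have hcen : ∑ z ∈ B.erase p, y z + (if p = r then y v else 0) = μ * y p := by
    rw [← hy p, hsum p hp]
    congr 1
    rw [← Finset.add_sum_erase B _ hp]
    have h0 : ¬ T.Adj p p := T.irrefl
    simp only [adjMat, h0, if_false, zero_mul, zero_add]
    refine Finset.sum_congr rfl fun z hz => ?_
    rw [Finset.mem_erase] at hz
    have := hs p hp z hz.2
    simp [this, hz.1]
  have hmul : ∑ z ∈ B.erase p, μ * y z + μ * (if p = r then y v else 0) = (k + 2) * y p := by
    rw [← Finset.mul_sum, ← mul_add, hcen, ← hμ]; ring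
  have hsub : ∑ z ∈ B.erase p, μ * y z =
      k * y p + ∑ z ∈ B.erase p, (if z = r then y v else 0) := by
    rw [← Finset.sum_congr rfl (fun z hz => hleaf z (Finset.mem_erase.mp hz).2
      (Finset.mem_erase.mp hz).1), Finset.sum_add_distrib, Finset.sum_const,
      Finset.card_erase_of_mem hp, hc]
    simp
  rw [hsub, Finset.sum_ite_eq'] at hmul
  by_cases hrp : r = p
  · subst hrp
    simp only [Finset.mem_erase, ne_eq, not_true, false_and, if_false, if_true] at hmul
    refine ⟨fun _ => by linarith, fun h => absurd rfl h, ?_⟩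
    intro hv0 z hz
    have hr0 : y r = 0 := by rw [hv0] at hmul; linarith
    by_cases hzr : z = r
    · rw [hzr, hr0]
    · have := hleaf z hz hzr
      simp only [hzr, if_false, hr0] at this
      have : μ * y z = 0 := by linarith
      simpa [hμ0.ne'] using this
  · have hmem : r ∈ B.erase p := Finset.mem_erase.mpr ⟨hrp, hr⟩
    simp only [hmem, if_true, Ne.symm hrp, if_false] at hmul
    refine ⟨fun h => absurd h hrp, fun _ => ?_, ?_⟩
    · have := hleaf r hr hrp
      simp only [if_true] at this
      linarith
    · intro hv0 z hz
      have hp0 : y p = 0 := by rw [hv0] at hmul; linarith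
      by_cases hzp : z = p
      · rw [hzp, hp0]
      · have := hleaf z hz hzp
        rw [hp0, hv0] at this
        have : μ * y z = 0 := by
          rw [← this]; simp
        simpa [hμ0.ne'] using this

lemma centres_eq {n k : ℕ} (hk : 2 ≤ k) (T : SimpleGraph (Fin n)) (v r1 r2 p1 p2 : Fin n)
    (B1 B2 : Finset (Fin n)) (h : TwoStars T k v r1 r2 p1 p2 B1 B2)
    (y : Fin n → ℝ) (μ : ℝ) (hμ0 : 0 < μ) (hμ : μ ^ 2 = k + 2)
    (hyy : ∑ i, y i * y i = 1)
    (hy : ∀ i, ∑ j, adjMat T i j * y j = μ * y i) : r1 = p1 ∧ r2 = p2 := by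
  obtain ⟨a1, b1, c1⟩ := star_eig T v r1 p1 B1 h.hr1 h.hp1 h.hv1 h.hc1 h.hs1 h.ho1 y μ hμ0 hμ hy
  obtain ⟨a2, b2, c2⟩ := star_eig T v r2 p2 B2 h.hr2 h.hp2 h.hv2 h.hc2 h.hs2 h.ho2 y μ hμ0 hμ hy
  have hv : y v ≠ 0 := by
    intro hv0
    have : ∀ z, y z = 0 := by
      intro z
      rcases h.hu z with rfl | hz | hz
      · exact hv0
      · exact c1 hv0 z hz
      · exact c2 hv0 z hz
    simp [this] at hyy
  have hne : r1 ≠ r2 := fun e => Finset.disjoint_left.mp h.hd h.hr1 (e ▸ h.hr2)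
  have hadj : ∀ z, T.Adj v z ↔ z = r1 ∨ z = r2 := by
    intro z
    rcases h.hu z with rfl | hz | hz
    · have e1 : z ≠ r1 := fun e => h.hv1 (e ▸ h.hr1)
      have e2 : z ≠ r2 := fun e => h.hv2 (e ▸ h.hr2)
      simp [e1, e2]
    · have e2 : z ≠ r2 := fun e => Finset.disjoint_left.mp h.hd hz (e ▸ h.hr2)
      rw [T.adj_comm, h.ho1 z hz v h.hv1]
      simp [e2]
    · have e2 : z ≠ r1 := fun e => Finset.disjoint_left.mp h.hd h.hr1 (e ▸ hz)
      rw [T.adj_comm, h.ho2 z hz v h.hv2]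
      simp [e2]
  have hsum : y r1 + y r2 = μ * y v := by
    rw [← hy v, ← Finset.sum_subset (Finset.subset_univ {r1, r2}), Finset.sum_pair hne]
    · simp [adjMat, hadj]
    · intro j _ hj
      have : ¬ T.Adj v j := by rw [hadj]; simpa using hj
      simp [adjMat, this]
  have hk' : (2 : ℝ) ≤ k := by exact_mod_cast hk
  have hcontra : μ ^ 2 * y v = 3 * y v → False := by
    intro e
    have := mul_right_cancel₀ hv e
    linarith
  by_cases e1 : r1 = p1 <;> by_cases e2 : r2 = p2
  · exact ⟨e1, e2⟩
  · exfalso; apply hcontra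
    have f1 := a1 e1
    have f2 := b2 e2
    linear_combination (-2 * μ) * hsum + μ * f1 + f2
  · exfalso; apply hcontra
    have f1 := b1 e1
    have f2 := a2 e2
    linear_combination (-2 * μ) * hsum + f1 + μ * f2
  · exfalso; apply hcontra
    have f1 := b1 e1
    have f2 := b2 e2
    linear_combination (-μ) * hsum + (1/2) * f1 + (1/2) * f2

/-- adjacency pattern of the five vertex types of `DC(k,k,3)` -/
def tyRel (a b : Fin 5) : Bool :=
  (a == 0 && b == 1) || (a == 1 && b == 0) || (a == 1 && b == 2) || (a == 2 && b == 1) ||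
  (a == 0 && b == 3) || (a == 3 && b == 0) || (a == 2 && b == 4) || (a == 4 && b == 2)

/-- number of vertices of each type -/
def tyCard (k : ℕ) : Fin 5 → ℕ := ![1, 1, 1, k, k]

def dcTy (k : ℕ) (i : Fin (k + k + 3)) : Fin 5 :=
  if (i : ℕ) = 0 then 0 else if (i : ℕ) = 1 then 1 else if (i : ℕ) = 2 then 2
  else if (i : ℕ) < 3 + k then 3 else 4

lemma dc_adj (k : ℕ) (i j : Fin (k + k + 3)) :
    (doubleComet k k 3).Adj i j ↔ tyRel (dcTy k i) (dcTy k j) = true := by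
  obtain ⟨i, hi⟩ := i
  obtain ⟨j, hj⟩ := j
  simp only [doubleComet, SimpleGraph.fromRel_adj, dcTy, ne_eq, Fin.mk.injEq]
  split_ifs <;> simp [tyRel] <;> omega

lemma dc_card (k : ℕ) (hk : 0 < k) (t : Fin 5) :
    (Finset.univ.filter fun i => dcTy k i = t).card = tyCard k t := by
  have hone : ∀ a : Fin (k + k + 3), ∀ t : Fin 5, (∀ i, dcTy k i = t ↔ i = a) →
      (Finset.univ.filter fun i => dcTy k i = t).card = 1 := by
    intro a t h
    rw [Finset.card_eq_one]
    refine ⟨a, ?_⟩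
    ext i
    rw [Finset.mem_filter, h i]
    simp
  fin_cases t
  · apply hone ⟨0, by omega⟩
    intro i
    simp only [dcTy, Fin.ext_iff]
    split_ifs <;> simp_all
  · apply hone ⟨1, by omega⟩
    intro i
    simp only [dcTy, Fin.ext_iff]
    split_ifs <;> simp_all
  · apply hone ⟨2, by omega⟩
    intro i
    simp only [dcTy, Fin.ext_iff]
    split_ifs <;> simp_all
  · have : (Finset.univ.filter fun i => dcTy k i = 3) =
        Finset.Ico (⟨3, by omega⟩ : Fin (k + k + 3)) ⟨3 + k, by omega⟩ := by
      ext i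
      rw [Finset.mem_filter, Finset.mem_Ico]
      simp only [Finset.mem_univ, true_and, Fin.le_def, Fin.lt_def, dcTy]
      split_ifs <;> simp <;> omega
    simp only [tyCard]
    refine (congrArg Finset.card this).trans ?_
    simp
  · have : (Finset.univ.filter fun i => dcTy k i = 4) =
        Finset.Ici (⟨3 + k, by omega⟩ : Fin (k + k + 3)) := by
      ext i
      rw [Finset.mem_filter, Finset.mem_Ici]
      simp only [Finset.mem_univ, true_and, Fin.le_def, dcTy]
      split_ifs <;> simp <;> omega
    refine (congrArg Finset.card this).trans ?_
    simp [tyCard]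
    omega

lemma dc_sum {M : Type} [AddCommMonoid M] (k : ℕ) (hk : 0 < k) (g : Fin 5 → M) :
    ∑ i, g (dcTy k i) = g 0 + g 1 + g 2 + k • g 3 + k • g 4 := by
  rw [← Finset.sum_fiberwise Finset.univ (dcTy k)]
  have : ∀ t, ∑ i ∈ Finset.univ.filter (fun i => dcTy k i = t), g (dcTy k i) =
      tyCard k t • g t := by
    intro t
    rw [← dc_card k hk t, ← Finset.sum_const]
    refine Finset.sum_congr rfl fun i hi => ?_
    rw [(Finset.mem_filter.mp hi).2]
  simp only [this]
  simp [Fin.sum_univ_five, tyCard]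

lemma dc_isTree (k : ℕ) (hk : 0 < k) : (doubleComet k k 3).IsTree := by
  rw [SimpleGraph.isTree_iff_connected_and_card]
  constructor
  · rw [SimpleGraph.connected_iff_exists_forall_reachable]
    refine ⟨⟨1, by omega⟩, ?_⟩
    have h0 : (doubleComet k k 3).Adj ⟨1, by omega⟩ ⟨0, by omega⟩ := by
      rw [dc_adj]; simp [dcTy, tyRel]
    have h2 : (doubleComet k k 3).Adj ⟨1, by omega⟩ ⟨2, by omega⟩ := by
      rw [dc_adj]; simp [dcTy, tyRel]
    intro w
    by_cases w0 : w = ⟨0, by omega⟩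
    · rw [w0]; exact h0.reachable
    by_cases w1 : w = ⟨1, by omega⟩
    · rw [w1]
    by_cases w2 : w = ⟨2, by omega⟩
    · rw [w2]; exact h2.reachable
    rw [Fin.ext_iff] at w0 w1 w2
    by_cases w3 : (w : ℕ) < 3 + k
    · refine h0.reachable.trans (SimpleGraph.Adj.reachable ?_)
      rw [dc_adj]; simp_all [dcTy, tyRel]
    · refine h2.reachable.trans (SimpleGraph.Adj.reachable ?_)
      rw [dc_adj]; simp_all [dcTy, tyRel]
  · have h1 := (doubleComet k k 3).sum_degrees_eq_twice_card_edges
    have h3 : ∀ i, (doubleComet k k 3).degree i =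
        ∑ j, if tyRel (dcTy k i) (dcTy k j) = true then 1 else 0 := by
      intro i
      rw [← SimpleGraph.card_neighborFinset_eq_degree, SimpleGraph.neighborFinset_eq_filter,
        Finset.card_filter]
      simp only [dc_adj]
    have h4 : ∀ i, (doubleComet k k 3).degree i =
        (fun t => (fun t' => if tyRel t t' = true then 1 else 0) 0 +
          (fun t' => if tyRel t t' = true then 1 else 0) 1 +
          (fun t' => if tyRel t t' = true then 1 else 0) 2 +
          k • (fun t' => if tyRel t t' = true then 1 else 0) 3 +
          k • (fun t' => if tyRel t t' = true then 1 else 0) 4) (dcTy k i) := by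
      intro i
      rw [h3 i]
      exact dc_sum k hk (fun t' => if tyRel (dcTy k i) t' = true then 1 else 0)
    rw [Finset.sum_congr rfl (fun i _ => h4 i)] at h1
    have h5 := dc_sum k hk (M := ℕ)
        (fun t => (fun t' => if tyRel t t' = true then 1 else 0) 0 +
          (fun t' => if tyRel t t' = true then 1 else 0) 1 +
          (fun t' => if tyRel t t' = true then 1 else 0) 2 +
          k • (fun t' => if tyRel t t' = true then 1 else 0) 3 +
          k • (fun t' => if tyRel t t' = true then 1 else 0) 4)
    replace h1 := h5.symm.trans h1
    simp [tyRel] at h1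
    rw [Nat.card_eq_fintype_card, Nat.card_eq_fintype_card, ← SimpleGraph.edgeFinset_card,
      Fintype.card_fin]
    omega

lemma dc_eig (k : ℕ) (hk : 0 < k) (φ : Fin 5 → ℝ) (μ : ℝ)
    (h0 : φ 1 + k * φ 3 = μ * φ 0) (h1 : φ 0 + φ 2 = μ * φ 1) (h2 : φ 1 + k * φ 4 = μ * φ 2)
    (h3 : φ 0 = μ * φ 3) (h4 : φ 2 = μ * φ 4) (i : Fin (k + k + 3)) :
    ∑ j, adjMat (doubleComet k k 3) i j * φ (dcTy k j) = μ * φ (dcTy k i) := by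
  simp only [adjMat, dc_adj]
  rw [dc_sum k hk (fun t => (if tyRel (dcTy k i) t = true then 1 else 0) * φ t)]
  generalize dcTy k i = t
  fin_cases t <;> simp [tyRel] <;> assumption

lemma dc_lam (k : ℕ) (hk : 0 < k) :
    √((k : ℝ) + 2) ≤ lam 1 (doubleComet k k 3) ∧ √(k : ℝ) ≤ lam 2 (doubleComet k k 3) := by
  have hS : √((k : ℝ) + 2) * √((k : ℝ) + 2) = k + 2 := Real.mul_self_sqrt (by positivity)
  have hR : √(k : ℝ) * √(k : ℝ) = k := Real.mul_self_sqrt (by positivity)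
  refine lam_ge _ (by omega) _ _ (Real.sqrt_lt_sqrt (by positivity) (by linarith))
    (fun i => (![√((k : ℝ) + 2), 2, √((k : ℝ) + 2), 1, 1] : Fin 5 → ℝ) (dcTy k i))
    (fun i => (![√(k : ℝ), 0, -√(k : ℝ), 1, -1] : Fin 5 → ℝ) (dcTy k i)) ?_ ?_ ?_ ?_
  · intro h
    have := congrFun h ⟨1, by omega⟩
    simp [dcTy] at this
  · intro h
    have := congrFun h ⟨3, by omega⟩
    simp [dcTy, hk] at this
  · apply dc_eig k hk <;> simp <;> linarith
  · apply dc_eig k hk <;> simp <;> linarith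

lemma iso_of_types {n m : ℕ} (G : SimpleGraph (Fin n)) (H : SimpleGraph (Fin m))
    (τ : Fin n → Fin 5) (σ : Fin m → Fin 5)
    (hG : ∀ i j, G.Adj i j ↔ tyRel (τ i) (τ j) = true)
    (hH : ∀ i j, H.Adj i j ↔ tyRel (σ i) (σ j) = true)
    (hc : ∀ t, (Finset.univ.filter fun i => τ i = t).card =
      (Finset.univ.filter fun i => σ i = t).card) : Nonempty (G ≃g H) := by
  have he : ∀ t, Nonempty ({i // τ i = t} ≃ {i // σ i = t}) := by
    intro t
    refine ⟨Fintype.equivOfCardEq ?_⟩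
    rw [Fintype.card_subtype, Fintype.card_subtype]
    exact hc t
  have e : ∀ t, {i // τ i = t} ≃ {i // σ i = t} := fun t => Classical.choice (he t)
  let E : Fin n ≃ Fin m := (Equiv.sigmaFiberEquiv τ).symm.trans
    ((Equiv.sigmaCongrRight e).trans (Equiv.sigmaFiberEquiv σ))
  have hE : ∀ i, σ (E i) = τ i := by
    intro i
    exact (e (τ i) ⟨i, rfl⟩).2
  refine ⟨⟨E, ?_⟩⟩
  intro i j
  rw [hH, hG, hE, hE]

lemma twoStars_iso {n k : ℕ} (hk : 0 < k) (T : SimpleGraph (Fin n)) (v p1 p2 : Fin n)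
    (B1 B2 : Finset (Fin n)) (h : TwoStars T k v p1 p2 p1 p2 B1 B2) :
    Nonempty (T ≃g doubleComet k k 3) := by
  set τ : Fin n → Fin 5 := fun z =>
    if z = p1 then 0 else if z = v then 1 else if z = p2 then 2 else if z ∈ B1 then 3 else 4 with hτ
  have v1 : v ≠ p1 := fun e => h.hv1 (e ▸ h.hp1)
  have v2 : v ≠ p2 := fun e => h.hv2 (e ▸ h.hp2)
  have hdis : ∀ z ∈ B1, z ∉ B2 := fun z hz => Finset.disjoint_left.mp h.hd hz
  have h12 : p1 ≠ p2 := fun e => hdis p1 h.hp1 (e ▸ h.hp2)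
  have hp2B1 : p2 ∉ B1 := fun e => hdis p2 e h.hp2
  have hvB1 := h.hv1
  have hvB2 := h.hv2
  have hp1 := h.hp1
  have hp2 := h.hp2
  have hu := h.hu
  refine iso_of_types T _ τ (dcTy k) ?_ (dc_adj k) ?_
  · have key1 : ∀ z ∈ B1, ∀ w, T.Adj z w ↔ tyRel (τ z) (τ w) = true := by
      intro z hz w
      have hzv : z ≠ v := fun e => hvB1 (e ▸ hz)
      have hz2 : z ≠ p2 := fun e => hp2B1 (e ▸ hz)
      by_cases hw : w ∈ B1
      · have hwv : w ≠ v := fun e => hvB1 (e ▸ hw)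
        have hw2 : w ≠ p2 := fun e => hp2B1 (e ▸ hw)
        rw [h.hs1 z hz w hw]
        by_cases a : z = p1 <;> by_cases b : w = p1 <;>
          simp [hτ, a, b, hz, hw, hzv, hz2, hwv, hw2, tyRel]
      · rw [h.ho1 z hz w hw]
        have hw1 : w ≠ p1 := fun e => hw (e ▸ hp1)
        by_cases a : z = p1 <;> by_cases b : w = v <;> by_cases c : w = p2 <;>
          simp [hτ, a, b, c, hz, hw, hzv, hz2, hw1, v1, v2, v2.symm, h12, h12.symm, hp2B1, tyRel]
    have key2 : ∀ z ∈ B2, ∀ w, T.Adj z w ↔ tyRel (τ z) (τ w) = true := by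
      intro z hz w
      have hzv : z ≠ v := fun e => hvB2 (e ▸ hz)
      have hz1 : z ≠ p1 := fun e => hdis p1 hp1 (e ▸ hz)
      have hzB1 : z ∉ B1 := fun e => hdis z e hz
      by_cases hw : w ∈ B2
      · have hwv : w ≠ v := fun e => hvB2 (e ▸ hw)
        have hw1 : w ≠ p1 := fun e => hdis p1 hp1 (e ▸ hw)
        have hwB1 : w ∉ B1 := fun e => hdis w e hw
        rw [h.hs2 z hz w hw]
        by_cases a : z = p2 <;> by_cases b : w = p2 <;>
          simp [hτ, a, b, hzB1, hwB1, hzv, hz1, hwv, hw1, v2.symm, h12.symm, hp2B1, tyRel]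
      · rw [h.ho2 z hz w hw]
        have hw2 : w ≠ p2 := fun e => hw (e ▸ hp2)
        have hw' := hu w
        by_cases a : z = p2 <;> by_cases b : w = v <;> by_cases c : w = p1 <;>
          by_cases d : w ∈ B1 <;>
          simp_all [tyRel]
    intro z w
    rcases hu z with rfl | hz | hz
    · rcases hu w with rfl | hw | hw
      · simp [hτ, v1, tyRel]
      · rw [T.adj_comm, key1 w hw z]
        generalize τ w = a
        generalize τ z = b
        revert a b
        decide
      · rw [T.adj_comm, key2 w hw z]
        generalize τ w = a
        generalize τ z = b
        revert a b
        decide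
    · exact key1 z hz w
    · exact key2 z hz w
  · intro t
    rw [dc_card k hk]
    fin_cases t
    · rw [show tyCard k _ = 1 from rfl, Finset.card_eq_one]
      refine ⟨p1, ?_⟩
      ext z
      simp only [hτ, Finset.mem_filter, Finset.mem_univ, true_and, Finset.mem_singleton]
      split_ifs <;> simp_all
    · rw [show tyCard k _ = 1 from rfl, Finset.card_eq_one]
      refine ⟨v, ?_⟩
      ext z
      simp only [hτ, Finset.mem_filter, Finset.mem_univ, true_and, Finset.mem_singleton]
      split_ifs <;> simp_all [eq_comm]
    · rw [show tyCard k _ = 1 from rfl, Finset.card_eq_one]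
      refine ⟨p2, ?_⟩
      ext z
      simp only [hτ, Finset.mem_filter, Finset.mem_univ, true_and, Finset.mem_singleton]
      split_ifs <;> simp_all [eq_comm]
    · rw [show tyCard k _ = k from rfl]
      have : k = (B1.erase p1).card := by rw [Finset.card_erase_of_mem hp1, h.hc1]; rfl
      rw [this]
      congr 1
      ext z
      simp only [hτ, Finset.mem_filter, Finset.mem_univ, true_and, Finset.mem_erase]
      have := hu z
      split_ifs <;> simp_all
    · rw [show tyCard k _ = k from rfl]
      have : k = (B2.erase p2).card := by rw [Finset.card_erase_of_mem hp2, h.hc2]; rfl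
      rw [this]
      congr 1
      ext z
      simp only [hτ, Finset.mem_filter, Finset.mem_univ, true_and, Finset.mem_erase]
      have := hu z
      split_ifs <;> simp_all

lemma psi_arith (α s t S R : ℝ) (hα0 : 0 < α) (hα1 : α ≤ 1 / 2) (hR : 0 < R) (hRS : R < S)
    (htR : t ≤ R) (hs0 : s ^ 2 ≤ S ^ 2 + R ^ 2) (hst : 0 < t → s ^ 2 + t ^ 2 ≤ S ^ 2 + R ^ 2)
    (hpsi : α * S + (1 - α) * R ≤ α * s + (1 - α) * t) : t = R ∧ s = S := by
  have h1 : S + (R - t) ≤ s := by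
    have : α * (S + (R - t)) ≤ α * s := by nlinarith
    exact le_of_mul_le_mul_left this hα0
  rcases le_or_gt t 0 with ht | ht
  · exfalso
    have : S + R ≤ s := by linarith
    nlinarith [mul_pos hR (hR.trans hRS)]
  · have h2 := hst ht
    have h3 : (S + (R - t)) ^ 2 ≤ s ^ 2 := by
      apply pow_le_pow_left₀ _ h1
      linarith
    have h4 : t = R := by
      by_contra h
      have : 0 < R - t := by
        rcases lt_or_eq_of_le htR with h' | h'
        · linarith
        · exact absurd h' h
      nlinarith [mul_pos (sub_pos.mpr hRS) this]
    subst h4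
    refine ⟨rfl, le_antisymm ?_ (by linarith)⟩
    apply le_of_sq_le_sq _ (by linarith)
    linarith
/-- For fixed `0 < α ≤ 1/2` and all sufficiently large odd `n`, every maximizer of
`Ψ(·, α) = α λ₁ + (1 - α) λ₂` among trees on `n` vertices is isomorphic to
`DC((n-3)/2, (n-3)/2, 3)`. -/
theorem psi_max_odd (α : ℝ) (hα0 : 0 < α) (hα1 : α ≤ 1 / 2) :
    ∃ N : ℕ, ∀ n : ℕ, N ≤ n → Odd n →
      ∀ Tstar : SimpleGraph (Fin n), Tstar.IsTree →
        (∀ T : SimpleGraph (Fin n), T.IsTree →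
          α * lam 1 T + (1 - α) * lam 2 T ≤
            α * lam 1 Tstar + (1 - α) * lam 2 Tstar) →
        Nonempty (Tstar ≃g doubleComet ((n - 3) / 2) ((n - 3) / 2) 3) := by
  refine ⟨7, ?_⟩
  intro n hn hodd Tstar hT hmax
  obtain ⟨k, hk2, hnk⟩ : ∃ k, 2 ≤ k ∧ n = k + k + 3 := by
    obtain ⟨m, hm⟩ := hodd
    exact ⟨m - 1, by omega, by omega⟩
  have hkk : (n - 3) / 2 = k := by omega
  rw [hkk]
  subst hnk
  have hk : 0 < k := by omega
  have hkR : (0 : ℝ) < k := by exact_mod_cast hk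
  obtain ⟨d1, d2⟩ := dc_lam k hk
  have hdc := hmax _ (dc_isTree k hk)
  obtain ⟨u, w, huu, hww, huw, hu, hw⟩ := exists_eigvecs Tstar (by omega)
  have hts := lam_antitone Tstar (by omega)
  obtain ⟨hb1, hb2⟩ := second_bound (k := k) (by omega) hk Tstar hT u w _ _ hts huu hww huw hu hw
  set s := lam 1 Tstar
  set t := lam 2 Tstar
  set S := √((k : ℝ) + 2) with hS
  set R := √(k : ℝ) with hR
  have hS2 : S ^ 2 = k + 2 := Real.sq_sqrt (by positivity)
  have hR2 : R ^ 2 = k := Real.sq_sqrt (by positivity)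
  have hRpos : 0 < R := Real.sqrt_pos.mpr hkR
  have hRS : R < S := Real.sqrt_lt_sqrt (by positivity) (by linarith)
  have hpsi : α * S + (1 - α) * R ≤ α * s + (1 - α) * t := by
    have e1 := mul_le_mul_of_nonneg_left d1 hα0.le
    have e2 := mul_le_mul_of_nonneg_left d2 (show 0 ≤ 1 - α by linarith)
    linarith
  have hs : 0 < s := by
    by_contra h
    push Not at h
    have e1 : α * s ≤ 0 := mul_nonpos_of_nonneg_of_nonpos hα0.le h
    have e2 : (1 - α) * t ≤ 0 := mul_nonpos_of_nonneg_of_nonpos (by linarith) (hts.trans h)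
    have e3 : 0 < α * S := mul_pos hα0 (hRpos.trans hRS)
    have e4 : 0 ≤ (1 - α) * R := mul_nonneg (by linarith) hRpos.le
    linarith
  obtain ⟨v0⟩ := hT.connected.nonempty
  obtain ⟨t1, t2⟩ := trace_bound Tstar hT
    (fun i => if Even (Tstar.dist v0 i) then 1 else -1)
    (by intro i; split_ifs <;> norm_num)
    (by
      intro i j hij
      have := hT.dist_eq_dist_add_one_of_adj v0 hij
      by_cases a : Even (Tstar.dist v0 i) <;> by_cases b : Even (Tstar.dist v0 j)
      · grind
      · simp [a, b]
      · simp [a, b]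
      · grind)
    u w s t huu hww huw hs hu hw
  have hSR : ((k + k + 3 : ℕ) : ℝ) - 1 = S ^ 2 + R ^ 2 := by
    rw [hS2, hR2]; push_cast; ring
  rw [hSR] at t1 t2
  obtain ⟨htR, hsS⟩ := psi_arith α s t S R hα0 hα1 hRpos hRS hb1 t1 t2 hpsi
  obtain ⟨v, r1, r2, p1, p2, B1, B2, hstar⟩ := hb2 htR (by linarith)
  obtain ⟨rfl, rfl⟩ := centres_eq hk2 Tstar v r1 r2 p1 p2 B1 B2 hstar u s hs
    (by rw [hsS, hS2]) huu hu
  exact twoStars_iso hk Tstar v r1 r2 B1 B2 hstar
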